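/- arXiv:2506.14734 — 3 statements merged into one kernel-verified Lean document; each statement's English description precedes it below -/
import Mathlib

section
/- Let S be a string of length n over a finite totally ordered alphabet Σ, let π be an order-preserving permutation for S, and let i > 1 be an irreducible LPF_π position. Then for every j > 1 with π(j−1) < π(i−1) and rlce(i,j) = LPF_π[i], it holds that S[i−1] ≠ S[j−1]. -/
/-!
Common definitions: strings are modeled as functions `S : ℕ → A` with 1-based
positions `1,…,n`; patterns/substrings as `List A`.
-/

open scoped Classical

/-- Length of the longest common prefix of the suffixes `S[i,n]` and `S[j,n]`
(1-based indexing): the largest `k` with `i+k-1 ≤ n`, `j+k-1 ≤ n` and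
`S[i,i+k-1] = S[j,j+k-1]`. -/
noncomputable def rlce {A : Type*} (S : ℕ → A) (n i j : ℕ) : ℕ :=
  Nat.findGreatest
    (fun k => i + k ≤ n + 1 ∧ j + k ≤ n + 1 ∧ ∀ t < k, S (i + t) = S (j + t)) n

/-- `π` is order-preserving for the string `S[1,n]`: whenever `π i < π j` and
`S[i,i+1] = S[j,j+1]` (for `i, j ∈ [n-1]`), also `π (i+1) < π (j+1)`. -/
def OrderPres {A : Type*} (S : ℕ → A) (n : ℕ) (π : ℕ → ℕ) : Prop :=
  ∀ i j, 1 ≤ i → i < n → 1 ≤ j → j < n → π i < π j →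
    S i = S j → S (i + 1) = S (j + 1) → π (i + 1) < π (j + 1)

/-- `π` is a permutation of `{1,…,n}`. -/
def PermOn (π : ℕ → ℕ) (n : ℕ) : Prop :=
  Set.BijOn π (Set.Icc 1 n) (Set.Icc 1 n)

/-- Generalized Longest Previous Factor array `LPF_π` of `S[1,n]`:
`LPF_π[i] = 0` if `π i = 1`, and `LPF_π[i] = max { rlce(j,i) : j ∈ [n], π j < π i }`
otherwise. -/
noncomputable def LPF {A : Type*} (S : ℕ → A) (n : ℕ) (π : ℕ → ℕ) (i : ℕ) : ℕ :=
  if π i = 1 then 0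
  else ((Finset.Icc 1 n).filter (fun j => π j < π i)).sup (fun j => rlce S n j i)

/-- `i` is an irreducible `LPF_π` position: `i = 1` or `LPF_π[i] ≠ LPF_π[i-1] - 1`
(the right-hand side taken over the integers). -/
def Irr {A : Type*} (S : ℕ → A) (n : ℕ) (π : ℕ → ℕ) (i : ℕ) : Prop :=
  i = 1 ∨ (LPF S n π i : ℤ) ≠ (LPF S n π (i - 1) : ℤ) - 1

/-- The Path Decomposition Array `PDA_π = { i + LPF_π[i] : i ∈ [n] }`, as a finite set. -/
noncomputable def PDA {A : Type*} (S : ℕ → A) (n : ℕ) (π : ℕ → ℕ) : Finset ℕ :=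
  (Finset.Icc 1 n).image (fun i => i + LPF S n π i)

/-- The string `w` occurs in `S` starting at (1-based) position `i`. -/
def occursAt {A : Type*} (S : ℕ → A) (w : List A) (i : ℕ) : Prop :=
  ∀ (t : ℕ) (ht : t < w.length), S (i + t) = w.get ⟨t, ht⟩

/-- `w` is a substring of `S[1,n]`. -/
def IsSubstr {A : Type*} (S : ℕ → A) (n : ℕ) (w : List A) : Prop :=
  ∃ i, 1 ≤ i ∧ i + w.length ≤ n + 1 ∧ occursAt S w i

/-- `w` is a suffix of the prefix `S[1,j]`. -/
def SuffixOfPrefix {A : Type*} (S : ℕ → A) (w : List A) (j : ℕ) : Prop :=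
  w.length ≤ j ∧ occursAt S w (j - w.length + 1)

/-- `w` is a right-maximal substring of `S[1,n]`: it is a substring of `S[1,n]` and
either a suffix of `S[1,n]`, or it has two distinct one-character right-extensions
occurring in `S[1,n]`. -/
def RightMaximal {A : Type*} (S : ℕ → A) (n : ℕ) (w : List A) : Prop :=
  IsSubstr S n w ∧
    (SuffixOfPrefix S w n ∨
      ∃ a b : A, a ≠ b ∧ IsSubstr S n (w ++ [a]) ∧ IsSubstr S n (w ++ [b]))

/-- `T[1,n]` is a text: `n ≥ 1` and the terminator `T n` is strictly smaller than
(in particular, different from) every other symbol of the text. -/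
def IsText {A : Type*} [LT A] (T : ℕ → A) (n : ℕ) : Prop :=
  1 ≤ n ∧ ∀ i, 1 ≤ i → i < n → T n < T i

/-- The suffix `S[i,n]` as a list. -/
def sufList {A : Type*} (S : ℕ → A) (n i : ℕ) : List A :=
  (List.range (n + 1 - i)).map (fun t => S (i + t))

/-- The prefix `S[1,i]` as a list. -/
def preList {A : Type*} (S : ℕ → A) (i : ℕ) : List A :=
  (List.range i).map (fun t => S (1 + t))

/-- `SA` is the suffix array of `T[1,n]`: a permutation of `[n]` listing the starting
positions of the suffixes of `T` in increasing lexicographic order. -/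
def IsSA {A : Type*} [LinearOrder A] (T : ℕ → A) (n : ℕ) (SA : ℕ → ℕ) : Prop :=
  PermOn SA n ∧ ∀ i j, 1 ≤ i → i < j → j ≤ n →
    List.Lex (· < ·) (sufList T n (SA i)) (sufList T n (SA j))

/-- `g` is the inverse of `f` on `{1,…,n}`. -/
def IsInv (f g : ℕ → ℕ) (n : ℕ) : Prop :=
  (∀ i, 1 ≤ i → i ≤ n → g (f i) = i) ∧ (∀ i, 1 ≤ i → i ≤ n → f (g i) = i)

/-- `PA` is the prefix array of `T[1,n]`: a permutation of `[n]` listing the ending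
positions of the prefixes of `T` in increasing colexicographic order. -/
def IsPA {A : Type*} [LinearOrder A] (T : ℕ → A) (n : ℕ) (PA : ℕ → ℕ) : Prop :=
  PermOn PA n ∧ ∀ i j, 1 ≤ i → i < j → j ≤ n →
    List.Lex (· < ·) (preList T (PA i)).reverse (preList T (PA j)).reverse

/-- The Burrows–Wheeler transform: `BWT[i] = T[SA[i] - 1]`, with the convention
`T[0] := T[n]`. -/
def BWT {A : Type*} (T : ℕ → A) (n : ℕ) (SA : ℕ → ℕ) (i : ℕ) : A :=
  T (if SA i = 1 then n else SA i - 1)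

/-- The co-Burrows–Wheeler transform: `coBWT[i] = T[PA[i] + 1]`, with the convention
`T[n+1] := T[1]`. -/
def coBWT {A : Type*} (T : ℕ → A) (n : ℕ) (PA : ℕ → ℕ) (i : ℕ) : A :=
  T (if PA i = n then 1 else PA i + 1)

/-- Number of maximal equal-symbol runs of `B[1,n]` (for `n ≥ 1`). -/
noncomputable def runs {A : Type*} (B : ℕ → A) (n : ℕ) : ℕ :=
  1 + ((Finset.Icc 2 n).filter (fun i => B i ≠ B (i - 1))).card

theorem rlce_spec {A : Type*} (S : ℕ → A) (n i j : ℕ) (hi : i ≤ n) (hj : j ≤ n) :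
    i + rlce S n i j ≤ n + 1 ∧ j + rlce S n i j ≤ n + 1 ∧
      ∀ t < rlce S n i j, S (i + t) = S (j + t) := by
  have := Nat.findGreatest_spec
    (P := fun k => i + k ≤ n + 1 ∧ j + k ≤ n + 1 ∧ ∀ t < k, S (i + t) = S (j + t))
    (m := 0) (n := n) (Nat.zero_le _) ⟨by omega, by omega, fun t ht => by omega⟩
  exact this

theorem le_rlce {A : Type*} (S : ℕ → A) (n i j k : ℕ) (hi1 : 1 ≤ i)
    (hi : i + k ≤ n + 1) (hj : j + k ≤ n + 1) (h : ∀ t < k, S (i + t) = S (j + t)) :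
    k ≤ rlce S n i j :=
  Nat.le_findGreatest (by omega) ⟨hi, hj, h⟩

theorem le_LPF {A : Type*} (S : ℕ → A) (n : ℕ) (π : ℕ → ℕ) (hperm : PermOn π n)
    (i k : ℕ) (hk1 : 1 ≤ k) (hkn : k ≤ n) (h : π k < π i) :
    rlce S n k i ≤ LPF S n π i := by
  have h1 : 1 ≤ π k := (hperm.mapsTo (show k ∈ Set.Icc 1 n from ⟨hk1, hkn⟩)).1
  unfold LPF
  rw [if_neg (by omega)]
  exact Finset.le_sup (f := fun j => rlce S n j i) (by simp [hk1, hkn, h])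

theorem LPF_attained {A : Type*} (S : ℕ → A) (n : ℕ) (π : ℕ → ℕ) (i : ℕ)
    (h : 0 < LPF S n π i) :
    ∃ k, 1 ≤ k ∧ k ≤ n ∧ π k < π i ∧ rlce S n k i = LPF S n π i := by
  unfold LPF at h ⊢
  split_ifs at h ⊢ with h1
  · omega
  · obtain ⟨k, hk, hlt⟩ := Finset.lt_sup_iff.1 h
    obtain ⟨b, hb, hbe⟩ := Finset.exists_mem_eq_sup _ ⟨k, hk⟩ (fun j => rlce S n j i)
    simp only [Finset.mem_filter, Finset.mem_Icc] at hb
    exact ⟨b, hb.1.1, hb.1.2, hb.2, hbe.symm⟩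

/-- If `i > 1` is an irreducible `LPF_π` position, then for every
`j > 1` with `π (j-1) < π (i-1)` and `rlce(i,j) = LPF_π[i]`, it holds `S[i-1] ≠ S[j-1]`. -/
theorem irreducible_vs_preceding_char {A : Type*} [Fintype A] [LinearOrder A]
    (S : ℕ → A) (n : ℕ) (π : ℕ → ℕ)
    (hperm : PermOn π n) (hop : OrderPres S n π)
    (i : ℕ) (hi1 : 1 < i) (hin : i ≤ n) (hirr : Irr S n π i)
    (j : ℕ) (hj1 : 1 < j) (hjn : j ≤ n)
    (hπ : π (j - 1) < π (i - 1)) (hr : rlce S n i j = LPF S n π i) :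
    S (i - 1) ≠ S (j - 1) := by
  intro hS
  obtain ⟨a, rfl⟩ : ∃ a, i = a + 1 := ⟨i - 1, by omega⟩
  obtain ⟨b, rfl⟩ : ∃ b, j = b + 1 := ⟨j - 1, by omega⟩
  simp only [Nat.add_sub_cancel] at hπ hS
  rcases hirr with h | hirr
  · omega
  simp only [Nat.add_sub_cancel] at hirr
  obtain ⟨h1, h2, h3⟩ := rlce_spec S n (a + 1) (b + 1) hin hjn
  rw [hr] at h1 h2 h3
  have hge : LPF S n π (a + 1) + 1 ≤ LPF S n π a := by
    refine le_trans (le_rlce S n b a _ (by omega) (by omega) (by omega) ?_)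
      (le_LPF S n π hperm a b (by omega) (by omega) hπ)
    intro t ht
    rcases t with _ | t
    · exact hS.symm
    · have := h3 t (by omega)
      rw [show b + (t + 1) = b + 1 + t by omega, show a + (t + 1) = a + 1 + t by omega]
      exact this.symm
  have hge2 : LPF S n π (a + 1) + 2 ≤ LPF S n π a := by omega
  obtain ⟨k, hk1, hkn, hk, hke⟩ := LPF_attained S n π a (by omega)
  obtain ⟨g1, g2, g3⟩ := rlce_spec S n k a hkn (by omega)
  rw [hke] at g1 g2 g3
  have hlt := hop k a hk1 (by omega) (by omega) (by omega) hk (g3 0 (by omega)) (g3 1 (by omega))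
  have hle := le_LPF S n π hperm (a + 1) (k + 1) (by omega) (by omega) hlt
  have := le_rlce S n (k + 1) (a + 1) (LPF S n π (a + 1) + 1) (by omega) (by omega) (by omega) (by
    intro t ht
    have := g3 (t + 1) (by omega)
    rw [show k + 1 + t = k + (t + 1) by omega, show a + 1 + t = a + (t + 1) by omega]
    exact this)
  omega
end

section
/- Let S be a string of length n over a finite totally ordered alphabet Σ and let π be an order-preserving permutation for S. Then for every j ∈ [n], either j = i + LPF_π[i] for some irreducible LPF_π position i, or there exists an irreducible LPF_π position i with i ≤ j < i + LPF_π[i]. -/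
/-!
Common definitions: strings are modeled as functions `S : ℕ → A` with 1-based
positions `1,…,n`; patterns/substrings as `List A`.
-/

open scoped Classical

theorem exists_irr_aux {A : Type*} (S : ℕ → A) (n : ℕ) (π : ℕ → ℕ) (j : ℕ) (hj : 1 ≤ j) :
    ∃ i, 1 ≤ i ∧ i ≤ j ∧ Irr S n π i ∧ i + LPF S n π i = j + LPF S n π j := by
  induction j, hj using Nat.le_induction with
  | base => exact ⟨1, le_refl _, le_refl _, Or.inl rfl, rfl⟩
  | succ k hk ih =>
    by_cases h : Irr S n π (k + 1)
    · exact ⟨k + 1, by omega, le_refl _, h, rfl⟩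
    · obtain ⟨i, h1, h2, h3, h4⟩ := ih
      refine ⟨i, h1, by omega, h3, ?_⟩
      unfold Irr at h
      push Not at h
      have h5 := h.2
      rw [Nat.add_sub_cancel] at h5
      omega

/-- Every position `j ∈ [n]` is either of the form `i + LPF_π[i]` for an
irreducible position `i`, or lies inside a phrase: `i ≤ j < i + LPF_π[i]` for an
irreducible position `i`. -/
theorem position_covered_by_phrases {A : Type*} [Fintype A] [LinearOrder A]
    (S : ℕ → A) (n : ℕ) (π : ℕ → ℕ)
    (hperm : PermOn π n) (hop : OrderPres S n π) :
    ∀ j, 1 ≤ j → j ≤ n →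
      (∃ i, 1 ≤ i ∧ i ≤ n ∧ Irr S n π i ∧ j = i + LPF S n π i) ∨
      (∃ i, 1 ≤ i ∧ i ≤ n ∧ Irr S n π i ∧ i ≤ j ∧ j < i + LPF S n π i) := by
  intro j h1 h2
  obtain ⟨i, hi1, hij, hirr, he⟩ := exists_irr_aux S n π j h1
  by_cases h0 : LPF S n π j = 0
  · exact Or.inl ⟨i, hi1, by omega, hirr, by omega⟩
  · exact Or.inr ⟨i, hi1, by omega, hirr, hij, by omega⟩
end

section
/- Let T be a text of length n over a finite totally ordered alphabet Σ, let π be an order-preserving permutation for T, and let P ∈ Σ^m (m ≥ 1) occur in T at position i' (i.e., T[i', i'+m−1] = P). If LPF_π[i] = 0 for some i ∈ [i', i'+m−1], then the occurrence at i' is primary, i.e., LPF_π[i'] < m. -/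
/-!
Common definitions: strings are modeled as functions `S : ℕ → A` with 1-based
positions `1,…,n`; patterns/substrings as `List A`.
-/

open scoped Classical

theorem rlce_spec_aux {A : Type*} (T : ℕ → A) (n j i : ℕ) (hj : j ≤ n + 1) (hi : i ≤ n + 1) :
    j + rlce T n j i ≤ n + 1 ∧ i + rlce T n j i ≤ n + 1 ∧
      ∀ t < rlce T n j i, T (j + t) = T (i + t) := by
  have := Nat.findGreatest_spec (m := 0) (n := n)
    (P := fun k => j + k ≤ n + 1 ∧ i + k ≤ n + 1 ∧ ∀ t < k, T (j + t) = T (i + t))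
    (Nat.zero_le n) ⟨by omega, by omega, by intro t ht; omega⟩
  exact this

theorem rlce_pos_aux {A : Type*} (T : ℕ → A) (n j i : ℕ) (hn : 1 ≤ n) (hj : j ≤ n) (hi : i ≤ n)
    (h : T j = T i) : 1 ≤ rlce T n j i := by
  unfold rlce
  apply Nat.le_findGreatest hn
  refine ⟨by omega, by omega, ?_⟩
  intro t ht
  obtain rfl : t = 0 := by omega
  exact h

/-- If a pattern occurrence `T[i', i'+m-1] = P` crosses a position `i`
with `LPF_π[i] = 0` (a type-1 phrase), then the occurrence is primary: `LPF_π[i'] < m`. -/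
theorem crossing_type1_phrase_primary {A : Type*} [Fintype A] [LinearOrder A]
    (T : ℕ → A) (n : ℕ) (htext : IsText T n)
    (π : ℕ → ℕ) (hperm : PermOn π n) (hop : OrderPres T n π)
    (P : List A) (hm : 1 ≤ P.length)
    (i' : ℕ) (hi' : 1 ≤ i') (hbound : i' + P.length ≤ n + 1) (hocc : occursAt T P i')
    (i : ℕ) (hlo : i' ≤ i) (hhi : i ≤ i' + P.length - 1) (hz : LPF T n π i = 0) :
    LPF T n π i' < P.length := by
  by_contra hcon
  push Not at hcon
  have hex : ∃ j, 1 ≤ j ∧ j ≤ n ∧ π j < π i' ∧ P.length ≤ rlce T n j i' := by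
    unfold LPF at hcon
    split_ifs at hcon with h1
    · omega
    · by_contra hno
      push Not at hno
      have : ((Finset.Icc 1 n).filter (fun j => π j < π i')).sup
          (fun j => rlce T n j i') < P.length := by
        rw [Finset.sup_lt_iff (by simpa using Nat.lt_of_succ_le hm)]
        intro b hb
        simp only [Finset.mem_filter, Finset.mem_Icc] at hb
        exact hno b hb.1.1 hb.1.2 hb.2
      omega
  obtain ⟨j, hj1, hjn, hπ, hr⟩ := hex
  have hspec : j + rlce T n j i' ≤ n + 1 ∧ i' + rlce T n j i' ≤ n + 1 ∧
      ∀ t < rlce T n j i', T (j + t) = T (i' + t) :=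
    rlce_spec_aux T n j i' (by omega) (by omega)
  obtain ⟨ha, hb, hc⟩ := hspec
  have hind : ∀ d, d < P.length → π (j + d) < π (i' + d) := by
    intro d
    induction d with
    | zero => intro _; simpa using hπ
    | succ d ih =>
      intro hd
      exact hop (j + d) (i' + d) (by omega) (by omega) (by omega) (by omega)
        (ih (by omega)) (hc d (by omega)) (hc (d + 1) (by omega))
  obtain ⟨d, rfl⟩ := Nat.exists_eq_add_of_le hlo
  have hd : d < P.length := by omega
  have hlt := hind d hd
  have hpos : π (j + d) ∈ Set.Icc 1 n := hperm.mapsTo ⟨by omega, by omega⟩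
  have hne : π (i' + d) ≠ 1 := by have := hpos.1; omega
  have hrl : 1 ≤ rlce T n (j + d) (i' + d) :=
    rlce_pos_aux T n _ _ (by omega) (by omega) (by omega) (hc d (by omega))
  unfold LPF at hz
  rw [if_neg hne] at hz
  have hle : rlce T n (j + d) (i' + d) ≤
      ((Finset.Icc 1 n).filter (fun k => π k < π (i' + d))).sup
        (fun k => rlce T n k (i' + d)) :=
    Finset.le_sup (f := fun k => rlce T n k (i' + d))
      (by simp only [Finset.mem_filter, Finset.mem_Icc]; exact ⟨⟨by omega, by omega⟩, hlt⟩)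
  omega
end
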